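/- Let ω₁, …, ω_{n-2}, ω be positive definite Hermitian n×n matrices (identified with Kähler forms of constant coefficients on ℂⁿ). Then the quadratic form Q(X,Y) = D(ω₁,…,ω_{n-2},X,Y) on complex Hermitian matrices is negative definite on the hyperplane P = {X Hermitian : D(ω₁,…,ω_{n-2},ω,X) = 0}. -/

import Mathlib

open scoped ComplexOrder

/-- The mixed discriminant of `m` Hermitian `m × m` complex matrices: the full
polarization of the determinant, `D(A, …, A) = det A`. -/
noncomputable def mixedDisc {m : ℕ} (A : Fin m → Matrix (Fin m) (Fin m) ℂ) : ℝ :=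
  ((m.factorial : ℂ)⁻¹ *
    ∑ σ : Equiv.Perm (Fin m), (Matrix.of fun i j => A (σ j) i j).det).re

/-- `D(A₁, …, Aₙ, X, Y)` for a family of `n` matrices of size `n + 2` together
with two extra entries `X`, `Y`. -/
noncomputable def mixedDisc2 {n : ℕ} (A : Fin n → Matrix (Fin (n + 2)) (Fin (n + 2)) ℂ)
    (X Y : Matrix (Fin (n + 2)) (Fin (n + 2)) ℂ) : ℝ :=
  mixedDisc (Fin.snoc (Fin.snoc A X) Y)


open Polynomial

/-- The (unnormalised) mixed discriminant as a complex multilinear map. -/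
noncomputable def MD (m : ℕ) :
    MultilinearMap ℂ (fun _ : Fin m => Matrix (Fin m) (Fin m) ℂ) ℂ :=
  ∑ σ : Equiv.Perm (Fin m),
    ((Matrix.detRowAlternating (n := Fin m) (R := ℂ)).toMultilinearMap.compLinearMap
      (fun j : Fin m => (LinearMap.pi (fun i : Fin m =>
        Matrix.entryLinearMap ℂ ℂ i j) :
          Matrix (Fin m) (Fin m) ℂ →ₗ[ℂ] (Fin m → ℂ)))).domDomCongr σ

lemma MD_apply {m : ℕ} (A : Fin m → Matrix (Fin m) (Fin m) ℂ) :
    MD m A = ∑ σ : Equiv.Perm (Fin m), (Matrix.of fun i j => A (σ j) i j).det := by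
  unfold MD
  rw [sum_apply]
  refine Finset.sum_congr rfl fun σ _ => ?_
  rw [← Matrix.det_transpose]
  rfl

lemma mixedDisc_eq {m : ℕ} (A : Fin m → Matrix (Fin m) (Fin m) ℂ) :
    mixedDisc A = (m.factorial : ℝ)⁻¹ * (MD m A).re := by
  unfold mixedDisc
  rw [← MD_apply]
  have : ((m.factorial : ℂ)⁻¹) = (((m.factorial : ℝ)⁻¹ : ℝ) : ℂ) := by push_cast; rfl
  rw [this, Complex.re_ofReal_mul]

lemma MD_perm {m : ℕ} (A : Fin m → Matrix (Fin m) (Fin m) ℂ) (τ : Equiv.Perm (Fin m)) :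
    MD m (fun i => A (τ i)) = MD m A := by
  rw [MD_apply, MD_apply]
  exact Equiv.sum_comp (Equiv.mulLeft τ)
    (fun σ : Equiv.Perm (Fin m) => (Matrix.of fun i j => A (σ j) i j).det)

lemma MD_const {m : ℕ} (A : Matrix (Fin m) (Fin m) ℂ) :
    MD m (fun _ => A) = m.factorial * A.det := by
  rw [MD_apply]
  have : (Matrix.of fun i j => A i j) = A := rfl
  simp [this, Fintype.card_perm]

lemma MD_transpose {m : ℕ} (A : Fin m → Matrix (Fin m) (Fin m) ℂ) :
    MD m (fun i => (A i).transpose) = MD m A := by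
  rw [MD_apply, MD_apply]
  simp only [Matrix.det_apply, Matrix.of_apply, Matrix.transpose_apply]
  conv_lhs => rw [Finset.sum_comm]
  conv_rhs => rw [Finset.sum_comm]
  rw [← Equiv.sum_comp (Equiv.inv (Equiv.Perm (Fin m)))]
  refine Finset.sum_congr rfl fun τ _ => ?_
  rw [← Equiv.sum_comp (Equiv.mulRight τ⁻¹)]
  refine Finset.sum_congr rfl fun σ _ => ?_
  simp only [Equiv.inv_apply, Equiv.Perm.sign_inv, Equiv.coe_mulRight]
  congr 1
  rw [← Equiv.prod_comp τ]
  simp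

lemma MD_im {m : ℕ} (A : Fin m → Matrix (Fin m) (Fin m) ℂ) (hA : ∀ i, (A i).IsHermitian) :
    (MD m A).im = 0 := by
  rw [← Complex.conj_eq_iff_im]
  conv_rhs => rw [← MD_transpose]
  rw [MD_apply, MD_apply, map_sum]
  refine Finset.sum_congr rfl fun σ _ => ?_
  rw [RingHom.map_det]
  congr 1
  ext i j
  simp only [RingHom.mapMatrix_apply, Matrix.map_apply, Matrix.of_apply, Matrix.transpose_apply]
  exact (hA (σ j)).apply j i

lemma exists_poly {m : ℕ} (T : Finset (Fin m)) (A : Fin m → Matrix (Fin m) (Fin m) ℂ)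
    (Z W : Matrix (Fin m) (Fin m) ℂ) :
    ∃ p : ℂ[X], (∀ t : ℂ, p.eval t = MD m (T.piecewise A (fun _ => Z + t • W))) ∧
      p.coeff (Tᶜ.card) = MD m (T.piecewise A (fun _ => W)) ∧
      p.coeff 1 = ∑ i ∈ Tᶜ, MD m (Function.update (T.piecewise A (fun _ => Z)) i W) := by
  refine ⟨∑ s ∈ Tᶜ.powerset,
    C (MD m (s.piecewise (fun _ => W) (T.piecewise A (fun _ => Z)))) * X ^ s.card, ?_, ?_, ?_⟩
  · intro t
    have h : T.piecewise A (fun _ => Z + t • W) =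
        Tᶜ.piecewise ((fun _ => t • W) + T.piecewise A (fun _ => Z))
          (T.piecewise A (fun _ => Z)) := by
      ext1 i
      by_cases hi : i ∈ T <;> simp [hi, add_comm]
    rw [h, MultilinearMap.map_piecewise_add, eval_finsetSum]
    refine Finset.sum_congr rfl fun s _ => ?_
    have h2 : s.piecewise (fun _ => t • W) (T.piecewise A (fun _ => Z)) =
        s.piecewise (fun i => t • (s.piecewise (fun _ => W) (T.piecewise A (fun _ => Z))) i)
          (s.piecewise (fun _ => W) (T.piecewise A (fun _ => Z))) := by
      ext1 i
      by_cases hi : i ∈ s <;> simp [hi]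
    rw [h2, MultilinearMap.map_piecewise_smul]
    rw [eval_C_mul, eval_pow, eval_X, Finset.prod_const, smul_eq_mul, mul_comm]
  · rw [finsetSum_coeff, Finset.sum_eq_single Tᶜ]
    · simp only [coeff_C_mul, coeff_X_pow, if_true, mul_one]
      congr 1
      ext1 i
      by_cases hi : i ∈ T <;> simp [hi]
    · intro s hs hne
      rw [coeff_C_mul, coeff_X_pow, if_neg, mul_zero]
      intro hc
      exact hne (Finset.eq_of_subset_of_card_le (Finset.mem_powerset.1 hs) hc.le)
    · simp
  · rw [finsetSum_coeff]
    have : ∀ s ∈ Tᶜ.powerset,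
        (C (MD m (s.piecewise (fun _ => W) (T.piecewise A (fun _ => Z)))) * X ^ s.card).coeff 1 =
        if s.card = 1 then MD m (s.piecewise (fun _ => W) (T.piecewise A (fun _ => Z))) else 0 := by
      intro s _
      rw [coeff_C_mul, coeff_X_pow]
      split_ifs <;> simp_all
    rw [Finset.sum_congr rfl this, ← Finset.sum_filter, ← Finset.powersetCard_eq_filter,
      Finset.powersetCard_one, Finset.sum_map]
    refine Finset.sum_congr rfl fun i _ => ?_
    congr 1
    ext1 j
    by_cases hj : j = i
    · subst hj; simp
    · simp [hj]

/-- By symmetry, the place of the exceptional entry does not matter. -/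
lemma MD_update_swap {m : ℕ} (B : Fin m → Matrix (Fin m) (Fin m) ℂ) (i j : Fin m)
    (h : B i = B j) (W : Matrix (Fin m) (Fin m) ℂ) :
    MD m (Function.update B i W) = MD m (Function.update B j W) := by
  rw [← MD_perm _ (Equiv.swap i j)]
  congr 1
  ext1 k
  simp only [Function.update_apply, Equiv.swap_apply_def]
  split_ifs <;> simp_all

lemma coeff_one_aux {m : ℕ} (T : Finset (Fin m)) (A : Fin m → Matrix (Fin m) (Fin m) ℂ)
    (Z W : Matrix (Fin m) (Fin m) ℂ) (j : Fin m) (hj : j ∉ T) :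
    ∑ i ∈ Tᶜ, MD m (Function.update (T.piecewise A (fun _ => Z)) i W) =
      Tᶜ.card * MD m (Function.update (T.piecewise A (fun _ => Z)) j W) := by
  rw [← nsmul_eq_mul]
  apply Finset.sum_eq_card_nsmul
  intro i hi
  apply MD_update_swap
  simp [hj, Finset.mem_compl.1 hi]

lemma det_ne_zero_of_upper {m : ℕ} {X Y : Matrix (Fin m) (Fin m) ℂ} (hX : X.IsHermitian)
    (hY : Y.PosDef) : (X + Complex.I • Y).det ≠ 0 := by
  intro h
  obtain ⟨v, hv, h0⟩ := Matrix.exists_mulVec_eq_zero_iff.2 h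
  have h1 : star v ⬝ᵥ ((X + Complex.I • Y).mulVec v) = 0 := by rw [h0]; simp
  rw [Matrix.add_mulVec, Matrix.smul_mulVec, dotProduct_add, dotProduct_smul] at h1
  have h2 : (star v ⬝ᵥ X.mulVec v).im = 0 := hX.im_star_dotProduct_mulVec_self v
  have h3 := hY.dotProduct_mulVec_pos hv
  have h4 := congrArg Complex.im h1
  rw [Complex.lt_def] at h3
  simp [h2] at h4
  simp [h4] at h3

/-- Stability of the partially polarised determinant. -/
lemma stable {m : ℕ} (A : Fin m → Matrix (Fin m) (Fin m) ℂ) (T : Finset (Fin m)) :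
    (∀ i ∈ T, (A i).PosDef) → ∀ X Y : Matrix (Fin m) (Fin m) ℂ, X.IsHermitian → Y.PosDef →
      MD m (T.piecewise A (fun _ => X + Complex.I • Y)) ≠ 0 := by
  induction T using Finset.induction_on with
  | empty =>
    intro _ X Y hX hY
    rw [Finset.piecewise_empty, MD_const]
    exact mul_ne_zero (by exact_mod_cast m.factorial_ne_zero) (det_ne_zero_of_upper hX hY)
  | insert j T hj ih =>
    intro hA X Y hX hY
    have hAj : (A j).PosDef := hA j (by simp)
    have ih := ih (fun i hi => hA i (by simp [hi]))
    obtain ⟨p, hp, hpd, hp1⟩ := exists_poly T A (X + Complex.I • Y) (A j)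
    rw [coeff_one_aux T A _ _ j hj] at hp1
    have hcard : 0 < Tᶜ.card := Finset.card_pos.2 ⟨j, by simpa using hj⟩
    have hlead : MD m (T.piecewise A (fun _ => A j)) ≠ 0 := by
      have h := ih 0 (A j) (Matrix.isHermitian_zero) hAj
      intro h0
      apply h
      have h2 : T.piecewise A (fun _ => 0 + Complex.I • A j) =
        Tᶜ.piecewise (fun i => Complex.I • (T.piecewise A (fun _ => A j)) i)
          (T.piecewise A (fun _ => A j)) := by
        ext1 i
        by_cases hi : i ∈ T <;> simp [hi]
      rw [h2, (MD m).map_piecewise_smul (fun _ => Complex.I), h0, smul_zero]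
    have hdeg : 0 < p.degree := by
      by_contra hcon
      rw [not_lt] at hcon
      have := coeff_eq_zero_of_degree_lt (lt_of_le_of_lt hcon (by exact_mod_cast hcard) :
        p.degree < ((Tᶜ.card : ℕ) : WithBot ℕ))
      rw [hpd] at this
      exact hlead this
    have hroots : p.rootSet ℂ ⊆ {z : ℂ | z.im < 0} := by
      intro t ht
      rw [mem_rootSet, coe_aeval_eq_eval, hp] at ht
      by_contra hcon
      have him : 0 ≤ t.im := not_lt.1 hcon
      have := ih (X + (t.re : ℂ) • A j) (Y + (t.im : ℂ) • A j)
        (hX.add (by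
          have := hAj.isHermitian
          unfold Matrix.IsHermitian at *
          rw [Matrix.conjTranspose_smul, this]; simp))
        (hY.add_posSemidef (hAj.posSemidef.smul (by exact_mod_cast him)))
      apply this
      rw [← ht.2]
      congr 2
      ext1 _
      conv_rhs => rw [← Complex.re_add_im t]
      module
    have hsub := rootSet_derivative_subset_convexHull_rootSet hdeg
    have hins : (insert j T).piecewise A (fun _ => X + Complex.I • Y) =
        Function.update (T.piecewise A (fun _ => X + Complex.I • Y)) j (A j) := by
      rw [Finset.piecewise_insert]
    rw [hins]
    intro h0
    rw [h0, mul_zero] at hp1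
    have hd : p.derivative ≠ 0 := by
      intro h
      have := derivative_eq_zero.1 h
      rw [← natDegree_pos_iff_degree_pos] at hdeg
      omega
    have h00 : (0 : ℂ) ∈ p.derivative.rootSet ℂ := by
      rw [mem_rootSet, coe_aeval_eq_eval, ← coeff_zero_eq_eval_zero, coeff_derivative]
      exact ⟨hd, by simp [hp1]⟩
    have := convexHull_min hroots (convex_halfSpace_im_lt 0) (hsub h00)
    simp at this

lemma MD_continuous {m : ℕ} {f : ℝ → Fin m → Matrix (Fin m) (Fin m) ℂ}
    (hf : ∀ i, Continuous fun s => f s i) : Continuous fun s => MD m (f s) := by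
  simp only [MD_apply]
  refine continuous_finsetSum _ fun σ _ => Continuous.matrix_det ?_
  refine continuous_matrix fun i j => ?_
  exact (hf (σ j)).matrix_elem i j

lemma MD_re_ne {m : ℕ} (A : Fin m → Matrix (Fin m) (Fin m) ℂ) (hA : ∀ i, (A i).PosDef) :
    (MD m A).re ≠ 0 := by
  have h := stable A Finset.univ (fun i _ => hA i) 0 1 Matrix.isHermitian_zero Matrix.PosDef.one
  rw [Finset.piecewise_univ] at h
  intro h0
  exact h (Complex.ext h0 (MD_im A fun i => (hA i).isHermitian))

lemma MD_pos {m : ℕ} (A : Fin m → Matrix (Fin m) (Fin m) ℂ) (hA : ∀ i, (A i).PosDef) :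
    0 < (MD m A).re := by
  by_contra hcon
  rw [not_lt] at hcon
  let f : ℝ → Fin m → Matrix (Fin m) (Fin m) ℂ :=
    fun s i => ((1 - s : ℝ) : ℂ) • A i + ((s : ℝ) : ℂ) • (1 : Matrix (Fin m) (Fin m) ℂ)
  have hc : Continuous fun s => (MD m (f s)).re := by
    refine Complex.continuous_re.comp (MD_continuous fun i => ?_)
    simp only [f]
    fun_prop
  have h0 : f 0 = A := by ext1 i; simp [f]
  have h1 : f 1 = fun _ => 1 := by ext1 i; simp [f]
  have hiv := intermediate_value_Icc (zero_le_one (α := ℝ)) hc.continuousOn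
  have hz : (0 : ℝ) ∈ Set.Icc (MD m (f 0)).re (MD m (f 1)).re := by
    rw [h0, h1, MD_const]
    refine ⟨hcon, ?_⟩
    simp
  obtain ⟨s, hs, hs0⟩ := hiv hz
  refine MD_re_ne (f s) (fun i => ?_) hs0
  have e0 : (0 : ℂ) ≤ ((s : ℝ) : ℂ) := by exact_mod_cast hs.1
  have e1 : (0 : ℂ) ≤ ((1 - s : ℝ) : ℂ) := by
    rw [Complex.zero_le_real]; linarith [hs.2]
  rcases hs.1.eq_or_lt with h | h
  · rw [← h, h0]; exact hA i
  · exact Matrix.PosDef.posSemidef_add ((hA i).posSemidef.smul e1)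
      (Matrix.PosDef.one.smul (by exact_mod_cast h))

lemma posDef_sub_smul {m : ℕ} {A Y : Matrix (Fin m) (Fin m) ℂ} (hA : A.PosDef)
    (hY : Y.IsHermitian) : ∃ ε : ℝ, 0 < ε ∧ (A - (ε : ℂ) • Y).PosDef := by
  have hcont : ∀ B : Matrix (Fin m) (Fin m) ℂ,
      Continuous fun v : Fin m → ℂ => (star v ⬝ᵥ B.mulVec v).re := by
    intro B
    refine Complex.continuous_re.comp ?_
    exact Continuous.dotProduct continuous_star (Continuous.matrix_mulVec continuous_const continuous_id)
  have hcomp : IsCompact (Metric.sphere (0 : Fin m → ℂ) 1) := isCompact_sphere _ _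
  have key : ∃ ε : ℝ, 0 < ε ∧ ∀ v ∈ Metric.sphere (0 : Fin m → ℂ) 1,
      0 < (star v ⬝ᵥ A.mulVec v).re - ε * (star v ⬝ᵥ Y.mulVec v).re := by
    rcases (Metric.sphere (0 : Fin m → ℂ) 1).eq_empty_or_nonempty with he | hne
    · exact ⟨1, one_pos, by simp [he]⟩
    obtain ⟨u, hu, hmin⟩ := hcomp.exists_isMinOn hne (hcont A).continuousOn
    obtain ⟨w, hw, hmax⟩ := hcomp.exists_isMaxOn hne (hcont Y).continuousOn
    set c := (star u ⬝ᵥ A.mulVec u).re with hc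
    set C := (star w ⬝ᵥ Y.mulVec w).re with hC
    have hcpos : 0 < c := by
      have hu0 : u ≠ 0 := by rintro rfl; simp at hu
      have := hA.dotProduct_mulVec_pos hu0
      rw [Complex.lt_def] at this
      exact this.1
    refine ⟨c / (2 * (|C| + 1)), by positivity, fun v hv => ?_⟩
    have h1 : c ≤ (star v ⬝ᵥ A.mulVec v).re := hmin hv
    have h2 : (star v ⬝ᵥ Y.mulVec v).re ≤ C := hmax hv
    have h3 : c / (2 * (|C| + 1)) * (star v ⬝ᵥ Y.mulVec v).re ≤ c / (2 * (|C| + 1)) * (|C| + 1) :=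
      mul_le_mul_of_nonneg_left (by linarith [le_abs_self C]) (by positivity)
    have h4 : c / (2 * (|C| + 1)) * (|C| + 1) = c / 2 := by
      have : |C| + 1 ≠ 0 := by positivity
      field_simp
    linarith
  obtain ⟨ε, hε, h⟩ := key
  have hH : (A - (ε : ℂ) • Y).IsHermitian := by
    refine hA.isHermitian.sub ?_
    unfold Matrix.IsHermitian at *
    rw [Matrix.conjTranspose_smul, hY]; simp
  refine ⟨ε, hε, Matrix.PosDef.of_dotProduct_mulVec_pos hH fun x hx => ?_⟩
  have him : (star x ⬝ᵥ (A - (ε : ℂ) • Y).mulVec x).im = 0 := hH.im_star_dotProduct_mulVec_self x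
  rw [Complex.lt_def]
  refine ⟨?_, by simpa using him.symm⟩
  have hn : 0 < ‖x‖ := norm_pos_iff.2 hx
  have hs := h (((‖x‖⁻¹ : ℝ) : ℂ) • x) (by
    rw [mem_sphere_zero_iff_norm, norm_smul]
    simp [hn.ne'])
  simp only [star_smul, Matrix.mulVec_smul, smul_dotProduct, dotProduct_smul, smul_eq_mul,
    Complex.star_def, Complex.conj_ofReal, Complex.re_ofReal_mul] at hs
  rw [Matrix.sub_mulVec, Matrix.smul_mulVec, dotProduct_sub, dotProduct_smul, smul_eq_mul,
    Complex.sub_re, Complex.re_ofReal_mul, Complex.zero_re]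
  have hs2 : 0 < ‖x‖⁻¹ * ‖x‖⁻¹ *
      ((star x ⬝ᵥ A.mulVec x).re - ε * (star x ⬝ᵥ Y.mulVec x).re) := by
    linarith
  exact (mul_pos_iff_of_pos_left (by positivity)).1 hs2

lemma isHerm_smul {m : ℕ} {X : Matrix (Fin m) (Fin m) ℂ} (hX : X.IsHermitian) (c : ℝ) :
    ((c : ℂ) • X).IsHermitian := by
  unfold Matrix.IsHermitian at *
  rw [Matrix.conjTranspose_smul, hX]; simp

/-- The complex bilinear form in slots `a`, `b`. -/
noncomputable def BB {m : ℕ} (A : Fin m → Matrix (Fin m) (Fin m) ℂ) (a b : Fin m)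
    (U V : Matrix (Fin m) (Fin m) ℂ) : ℂ :=
  MD m (Function.update (Function.update A a U) b V)

section
variable {m : ℕ} (A : Fin m → Matrix (Fin m) (Fin m) ℂ) {a b : Fin m}

lemma BB_add_right (U V V' : Matrix (Fin m) (Fin m) ℂ) :
    BB A a b U (V + V') = BB A a b U V + BB A a b U V' := by
  simp [BB, MultilinearMap.map_update_add]

lemma BB_smul_right (c : ℂ) (U V : Matrix (Fin m) (Fin m) ℂ) :
    BB A a b U (c • V) = c * BB A a b U V := by
  simp [BB, MultilinearMap.map_update_smul]

lemma BB_symm (hab : a ≠ b) (U V : Matrix (Fin m) (Fin m) ℂ) :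
    BB A a b U V = BB A a b V U := by
  unfold BB
  rw [← MD_perm _ (Equiv.swap a b)]
  congr 1
  ext1 k
  simp only [Function.update_apply, Equiv.swap_apply_def]
  split_ifs <;> simp_all

lemma BB_add_left (hab : a ≠ b) (U U' V : Matrix (Fin m) (Fin m) ℂ) :
    BB A a b (U + U') V = BB A a b U V + BB A a b U' V := by
  rw [BB_symm A hab, BB_add_right, BB_symm A hab V, BB_symm A hab V]

lemma BB_smul_left (hab : a ≠ b) (c : ℂ) (U V : Matrix (Fin m) (Fin m) ℂ) :
    BB A a b (c • U) V = c * BB A a b U V := by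
  rw [BB_symm A hab, BB_smul_right, BB_symm A hab V]

lemma BB_im (hA : ∀ i, i ≠ a → i ≠ b → (A i).PosDef) {U V : Matrix (Fin m) (Fin m) ℂ}
    (hU : U.IsHermitian) (hV : V.IsHermitian) : (BB A a b U V).im = 0 := by
  apply MD_im
  intro i
  simp only [Function.update_apply]
  split_ifs with h1 h2
  · exact hV
  · exact hU
  · exact (hA i h2 h1).isHermitian

lemma BB_pos (hA : ∀ i, i ≠ a → i ≠ b → (A i).PosDef) {W : Matrix (Fin m) (Fin m) ℂ}
    (hW : W.PosDef) : 0 < (BB A a b W W).re := by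
  apply MD_pos
  intro i
  simp only [Function.update_apply]
  split_ifs with h1 h2
  · exact hW
  · exact hW
  · exact hA i h2 h1

lemma BB_semi (hab : a ≠ b) (hA : ∀ i, i ≠ a → i ≠ b → (A i).PosDef)
    {W X : Matrix (Fin m) (Fin m) ℂ} (hW : W.PosDef) (hX : X.IsHermitian)
    (h : (BB A a b W X).re = 0) : (BB A a b X X).re ≤ 0 := by
  by_contra hcon
  rw [not_le] at hcon
  have hWW := BB_pos A hA hW
  set s := Real.sqrt ((BB A a b X X).re / (BB A a b W W).re) with hs
  have hs2 : s ^ 2 * (BB A a b W W).re = (BB A a b X X).re := by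
    rw [hs, Real.sq_sqrt (by positivity)]
    field_simp
  have hspos : 0 < s := Real.sqrt_pos.2 (by positivity)
  have hst := stable A ({a, b}ᶜ) (by
    intro i hi
    simp at hi
    exact hA i hi.1 hi.2) X ((s : ℂ) • W) hX (hW.smul (by exact_mod_cast hspos))
  have hpw : ∀ Z : Matrix (Fin m) (Fin m) ℂ, MD m (({a, b}ᶜ : Finset (Fin m)).piecewise A
      (fun _ => Z)) = BB A a b Z Z := by
    intro Z
    unfold BB
    congr 1
    ext1 i
    by_cases h1 : i = b
    · simp [h1]
    · by_cases h2 : i = a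
      · subst h2; simp [h1]
      · simp [Finset.piecewise, h1, h2]
  rw [hpw] at hst
  apply hst
  have e1 : BB A a b W X = 0 := Complex.ext h (BB_im A hA hW.isHermitian hX)
  have e2 : BB A a b X W = 0 := by rw [BB_symm A hab, e1]
  have e3 : BB A a b X X = ((BB A a b X X).re : ℂ) :=
    Complex.ext rfl (by simpa using BB_im A hA hX hX)
  have e4 : BB A a b W W = ((BB A a b W W).re : ℂ) :=
    Complex.ext rfl (by simpa using BB_im A hA hW.isHermitian hW.isHermitian)
  simp only [BB_add_left A hab, BB_add_right, BB_smul_left A hab, BB_smul_right, e1, e2]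
  rw [e3, e4, ← hs2]
  push_cast
  linear_combination (s : ℂ) ^ 2 * ((BB A a b W W).re : ℂ) * Complex.I_sq

lemma BB_ker (hab : a ≠ b) (hA : ∀ i, i ≠ a → i ≠ b → (A i).PosDef)
    {W X : Matrix (Fin m) (Fin m) ℂ} (hW : W.PosDef) (hX : X.IsHermitian)
    (h : (BB A a b W X).re = 0) (h0 : (BB A a b X X).re = 0)
    {Y : Matrix (Fin m) (Fin m) ℂ} (hY : Y.IsHermitian) : (BB A a b Y X).re = 0 := by
  have hWW := BB_pos A hA hW
  set c : ℝ := - (BB A a b W Y).re / (BB A a b W W).re with hc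
  have hcW : (BB A a b W Y).re + c * (BB A a b W W).re = 0 := by
    rw [hc]; field_simp; ring
  set Y0 := Y + (c : ℂ) • W with hY0
  have hY0H : Y0.IsHermitian := hY.add (isHerm_smul hW.isHermitian c)
  have hWY0 : (BB A a b W Y0).re = 0 := by
    rw [hY0, BB_add_right, BB_smul_right, Complex.add_re, Complex.re_ofReal_mul, hcW]
  have hXY0 : (BB A a b Y0 X).re = (BB A a b Y X).re := by
    rw [hY0, BB_add_left A hab, BB_smul_left A hab, Complex.add_re, Complex.re_ofReal_mul, h]
    ring
  have hall : ∀ ε : ℝ, 2 * ε * (BB A a b Y0 X).re + ε ^ 2 * (BB A a b Y0 Y0).re ≤ 0 := by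
    intro ε
    have := BB_semi A hab hA hW (hX.add (isHerm_smul hY0H ε)) (by
      rw [BB_add_right, BB_smul_right, Complex.add_re, Complex.re_ofReal_mul, h, hWY0]; ring)
    simp only [BB_add_left A hab, BB_add_right, BB_smul_left A hab, BB_smul_right,
      Complex.add_re, Complex.re_ofReal_mul, h0, BB_symm A hab X Y0] at this
    linarith
  rw [← hXY0]
  set β := (BB A a b Y0 X).re
  set d := (BB A a b Y0 Y0).re
  have h1 := hall (β / (|d| + 1))
  have hd : 0 < |d| + 1 := by positivity
  have h2 : 2 * (β / (|d| + 1)) * β + (β / (|d| + 1)) ^ 2 * d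
      = β ^ 2 * (2 * |d| + 2 + d) / (|d| + 1) ^ 2 := by
    field_simp
  rw [h2, div_le_iff₀ (by positivity), zero_mul] at h1
  have h3 : 0 < 2 * |d| + 2 + d := by linarith [neg_abs_le d, abs_nonneg d]
  have h4 : β ^ 2 ≤ 0 := by
    by_contra hh
    exact absurd h1 (not_le.2 (mul_pos (not_le.1 hh) h3))
  exact pow_eq_zero_iff (two_ne_zero) |>.1 (le_antisymm h4 (sq_nonneg _))

lemma BB_step (hab : a ≠ b) (hA : ∀ i, i ≠ a → i ≠ b → (A i).PosDef)
    {X : Matrix (Fin m) (Fin m) ℂ} (hX : X.IsHermitian)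
    (hker : ∀ Y : Matrix (Fin m) (Fin m) ℂ, Y.IsHermitian → (BB A a b Y X).re = 0)
    {c : Fin m} (hca : c ≠ a) (hcb : c ≠ b) {P : Matrix (Fin m) (Fin m) ℂ} (hP : P.PosDef) :
    ∀ Y : Matrix (Fin m) (Fin m) ℂ, Y.IsHermitian →
      (BB (Function.update A c P) a b Y X).re = 0 := by
  have hA' : ∀ P : Matrix (Fin m) (Fin m) ℂ, P.PosDef → ∀ i, i ≠ a → i ≠ b →
      (Function.update A c P i).PosDef := by
    intro P hP i h1 h2
    simp only [Function.update_apply]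
    split_ifs with h
    · exact hP
    · exact hA i h1 h2
  have hsw : ∀ P : Matrix (Fin m) (Fin m) ℂ,
      BB (Function.update A c P) a b (A c) X = BB A a b P X := by
    intro P
    unfold BB
    rw [← MD_perm _ (Equiv.swap a c)]
    congr 1
    ext1 k
    simp only [Function.update_apply, Equiv.swap_apply_def]
    split_ifs <;> simp_all
  have hle : ∀ P : Matrix (Fin m) (Fin m) ℂ, P.PosDef →
      (BB (Function.update A c P) a b X X).re ≤ 0 := by
    intro P hP
    refine BB_semi _ hab (hA' P hP) (hA c hca hcb) hX ?_
    rw [hsw]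
    exact hker P hP.isHermitian
  obtain ⟨ε, hε, hpd⟩ := posDef_sub_smul (hA c hca hcb) hP.isHermitian
  have hlin : BB (Function.update A c (A c - (ε : ℂ) • P)) a b X X =
      BB A a b X X - (ε : ℂ) * BB (Function.update A c P) a b X X := by
    unfold BB
    have : ∀ Q : Matrix (Fin m) (Fin m) ℂ,
        Function.update (Function.update (Function.update A c Q) a X) b X =
        Function.update (Function.update (Function.update A a X) b X) c Q := by
      intro Q
      rw [Function.update_comm hca, Function.update_comm hcb]
    rw [this, this, MultilinearMap.map_update_sub, MultilinearMap.map_update_smul, smul_eq_mul]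
    congr 2
    rw [← this, Function.update_eq_self]
  have h1 := hle _ hpd
  rw [hlin, Complex.sub_re, Complex.re_ofReal_mul, hker X hX] at h1
  have h2 := hle P hP
  have h3 : (BB (Function.update A c P) a b X X).re = 0 := by
    have : 0 ≤ (BB (Function.update A c P) a b X X).re := by
      by_contra hh
      have := mul_neg_of_pos_of_neg hε (not_le.1 hh)
      linarith
    linarith
  intro Y hY
  refine BB_ker _ hab (hA' P hP) (hA c hca hcb) hX ?_ h3 hY
  rw [hsw]
  exact hker P hP.isHermitian

lemma BB_all (hab : a ≠ b) (hA : ∀ i, i ≠ a → i ≠ b → (A i).PosDef)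
    {X : Matrix (Fin m) (Fin m) ℂ} (hX : X.IsHermitian)
    (hker : ∀ Y : Matrix (Fin m) (Fin m) ℂ, Y.IsHermitian → (BB A a b Y X).re = 0)
    {P : Matrix (Fin m) (Fin m) ℂ} (hP : P.PosDef) (S : Finset (Fin m)) :
    (∀ i ∈ S, i ≠ a ∧ i ≠ b) → ∀ Y : Matrix (Fin m) (Fin m) ℂ, Y.IsHermitian →
      (BB (S.piecewise (fun _ => P) A) a b Y X).re = 0 := by
  induction S using Finset.induction_on with
  | empty => intro _; simpa using hker
  | insert c S hc ih =>
    intro hS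
    rw [Finset.piecewise_insert]
    refine BB_step _ hab ?_ hX (ih fun i hi => hS i (by simp [hi])) (hS c (by simp)).1
      (hS c (by simp)).2 hP
    intro i h1 h2
    by_cases hi : i ∈ S
    · simpa [hi] using hP
    · simpa [hi] using hA i h1 h2

lemma trace_zero (hab : a ≠ b) (hA : ∀ i, i ≠ a → i ≠ b → (A i).PosDef)
    {X : Matrix (Fin m) (Fin m) ℂ} (hX : X.IsHermitian)
    (hker : ∀ Y : Matrix (Fin m) (Fin m) ℂ, Y.IsHermitian → (BB A a b Y X).re = 0)
    {P : Matrix (Fin m) (Fin m) ℂ} (hP : P.PosDef) : (P⁻¹ * X).trace = 0 := by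
  have h := BB_all A hab hA hX hker hP ({a, b}ᶜ) (by simp) P hP.isHermitian
  have he : Function.update (Function.update
      (({a, b}ᶜ : Finset (Fin m)).piecewise (fun _ => P) A) a P) b X =
      Function.update (fun _ => P) b X := by
    ext1 i
    by_cases h1 : i = b
    · simp [h1]
    · by_cases h2 : i = a
      · subst h2; simp [h1]
      · simp [Finset.piecewise, h1, h2]
  unfold BB at h
  rw [he] at h
  have h0 : MD m (Function.update (fun _ => P) b X) = 0 := by
    refine Complex.ext h (MD_im _ fun i => ?_)
    simp only [Function.update_apply]
    split_ifs
    · exact hX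
    · exact hP.isHermitian
  obtain ⟨p, hp, -, hp1⟩ := exists_poly ∅ A P X
  rw [coeff_one_aux ∅ A P X b (by simp)] at hp1
  simp only [Finset.piecewise_empty, MD_const] at hp hp1
  rw [h0, mul_zero] at hp1
  have hdet : P.det ≠ 0 := hP.det_pos.ne'
  have hpe : p = C ((m.factorial : ℂ) * P.det) *
      (1 + (Polynomial.X : ℂ[X]) • (P⁻¹ * X).map C).det := by
    apply Polynomial.funext
    intro t
    rw [hp, eval_C_mul]
    have e1 : P + t • X = P * (1 + t • (P⁻¹ * X)) := by
      rw [mul_add, mul_one, Matrix.mul_smul, ← mul_assoc,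
        Matrix.mul_nonsing_inv _ (isUnit_iff_ne_zero.2 hdet), one_mul]
    have e2 : eval t (1 + (Polynomial.X : ℂ[X]) • (P⁻¹ * X).map C).det =
        (1 + t • (P⁻¹ * X)).det := by
      generalize P⁻¹ * X = N
      rw [← coe_evalRingHom, RingHom.map_det]
      congr 1
      ext i j
      by_cases hij : i = j <;> simp [hij] <;> ring
    rw [e2, e1, Matrix.det_mul]
    ring
  have hd : p.derivative.eval 0 = 0 := by
    rw [← coeff_zero_eq_eval_zero, coeff_derivative]
    simp [hp1]
  rw [hpe, derivative_C_mul, eval_C_mul, Matrix.derivative_det_one_add_X_smul] at hd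
  have hf : (m.factorial : ℂ) ≠ 0 := by exact_mod_cast m.factorial_ne_zero
  simpa [hf, hdet] using hd

lemma ker_zero (hab : a ≠ b) (hA : ∀ i, i ≠ a → i ≠ b → (A i).PosDef)
    {X : Matrix (Fin m) (Fin m) ℂ} (hX : X.IsHermitian)
    (hker : ∀ Y : Matrix (Fin m) (Fin m) ℂ, Y.IsHermitian → (BB A a b Y X).re = 0) :
    X = 0 := by
  have htr : ∀ P : Matrix (Fin m) (Fin m) ℂ, P.PosDef → (P * X).trace = 0 := by
    intro P hP
    have := trace_zero A hab hA hX hker hP.inv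
    rwa [Matrix.nonsing_inv_nonsing_inv _ (isUnit_iff_ne_zero.2 hP.det_pos.ne')] at this
  have hq : ∀ B : Matrix (Fin m) (Fin m) ℂ, B.IsHermitian → (B * B + 1).PosDef := by
    intro B hB
    have := Matrix.posSemidef_conjTranspose_mul_self B
    rw [hB] at this
    exact Matrix.PosDef.posSemidef_add this Matrix.PosDef.one
  have h1 := htr _ (hq (1 + X) (Matrix.isHermitian_one.add hX))
  have h2 := htr _ (hq (1 - X) (Matrix.isHermitian_one.sub hX))
  have h3 : (((1 + X) * (1 + X) + 1) * X) - (((1 - X) * (1 - X) + 1) * X) = (4 : ℂ) • (X * X) := by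
    have : (4 : ℂ) • (X * X) = X * X + X * X + X * X + X * X := by module
    rw [this]
    noncomm_ring
  have h4 := congrArg Matrix.trace h3
  rw [Matrix.trace_sub, h1, h2, Matrix.trace_smul] at h4
  have h5 : (X * X).trace = 0 := by simpa using h4.symm
  rw [← Matrix.trace_conjTranspose_mul_self_eq_zero_iff, hX]
  exact h5

end

lemma mixedDisc2_eq {n : ℕ} (ω : Fin n → Matrix (Fin (n + 2)) (Fin (n + 2)) ℂ)
    (U V : Matrix (Fin (n + 2)) (Fin (n + 2)) ℂ) :
    mixedDisc2 ω U V = ((n + 2).factorial : ℝ)⁻¹ *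
      (BB (Fin.snoc (Fin.snoc ω 0 : Fin (n + 1) → Matrix (Fin (n + 2)) (Fin (n + 2)) ℂ) 0 :
        Fin (n + 2) → Matrix (Fin (n + 2)) (Fin (n + 2)) ℂ)
        (Fin.castSucc (Fin.last n)) (Fin.last (n + 1)) U V).re := by
  unfold mixedDisc2 BB
  rw [mixedDisc_eq]
  congr 3
  ext1 i
  refine Fin.lastCases ?_ (fun i => ?_) i
  · simp
  · rw [Function.update_of_ne (Fin.castSucc_lt_last i).ne]
    refine Fin.lastCases ?_ (fun i => ?_) i
    · simp
    · rw [Function.update_of_ne (by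
        intro h
        exact (Fin.castSucc_lt_last i).ne (Fin.castSucc_injective _ h))]
      simp

theorem stmt12 {n : ℕ} (ω : Fin n → Matrix (Fin (n + 2)) (Fin (n + 2)) ℂ)
    (hω : ∀ i, (ω i).PosDef)
    (w : Matrix (Fin (n + 2)) (Fin (n + 2)) ℂ) (hw : w.PosDef) :
    ∀ X : Matrix (Fin (n + 2)) (Fin (n + 2)) ℂ, X.IsHermitian →
      mixedDisc2 ω w X = 0 → X ≠ 0 → mixedDisc2 ω X X < 0 := by
  intro X hX h hne
  have hf : (0 : ℝ) < ((n + 2).factorial : ℝ)⁻¹ :=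
    inv_pos.2 (by exact_mod_cast (n + 2).factorial_pos)
  rw [mixedDisc2_eq] at h ⊢
  have h0 := (mul_eq_zero.1 h).resolve_left hf.ne'
  have hab : Fin.castSucc (Fin.last n) ≠ Fin.last (n + 1) := (Fin.castSucc_lt_last _).ne
  have hA : ∀ i, i ≠ Fin.castSucc (Fin.last n) → i ≠ Fin.last (n + 1) →
      ((Fin.snoc (Fin.snoc ω 0 : Fin (n + 1) → Matrix (Fin (n + 2)) (Fin (n + 2)) ℂ) 0 :
        Fin (n + 2) → Matrix (Fin (n + 2)) (Fin (n + 2)) ℂ) i).PosDef := by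
    intro i
    refine Fin.lastCases ?_ (fun i => ?_) i
    · intro _ h; exact absurd rfl h
    · refine Fin.lastCases ?_ (fun i => ?_) i
      · intro h; exact absurd rfl h
      · intro _ _
        simpa using hω i
  refine mul_neg_of_pos_of_neg hf (lt_of_le_of_ne (BB_semi _ hab hA hw hX h0) fun h1 => hne ?_)
  exact ker_zero _ hab hA hX fun Y hY => BB_ker _ hab hA hw hX h0 h1 hY
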